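/- Let (a_n)_{n≥1} and (b_n)_{n≥1} be sequences of positive integers. Suppose that lim_{n→∞} (log B_{n+1})/(log B_n) = 1 and that limsup_{n→∞} (log Π_n)/(log B_n) ≤ ν for some real number ν < 1. Then the generalized continued fraction K_{n=1}^∞ a_n/b_n converges to an irrational number τ, and μ_I(τ) ≤ 2 + ν/(1 − ν). -/

import Mathlib

open Filter Real

/-- The asymptotic irrationality exponent: the infimum (in `EReal`, so that the
infimum of the empty set is `∞`) of all real `μ` for which there exist `c > 0`
and `N₀ > 0` with `|τ - M/N| ≥ c / N ^ μ` for all integers `M, N` with `N ≥ N₀`. -/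
noncomputable def muI (τ : ℝ) : EReal :=
  sInf ((fun μ : ℝ => (μ : EReal)) ''
    {μ : ℝ | ∃ c > (0:ℝ), ∃ N₀ > (0:ℝ), ∀ M N : ℤ,
      (N : ℝ) ≥ N₀ → |τ - (M : ℝ) / (N : ℝ)| ≥ c / (N : ℝ) ^ μ})

/-- Numerators of the convergents of the generalized continued fraction
`K_{n=1}^∞ a n / b n`. -/
def cfA (a b : ℕ → ℤ) : ℕ → ℤ
  | 0 => 0
  | 1 => a 1
  | (n + 2) => b (n + 2) * cfA a b (n + 1) + a (n + 2) * cfA a b n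

/-- Denominators of the convergents of the generalized continued fraction
`K_{n=1}^∞ a n / b n`. -/
def cfB (a b : ℕ → ℤ) : ℕ → ℤ
  | 0 => 1
  | 1 => b 1
  | (n + 2) => b (n + 2) * cfB a b (n + 1) + a (n + 2) * cfB a b n

/-- `Π n = a 1 * a 2 * ⋯ * a n`. -/
def cfPi (a : ℕ → ℤ) (n : ℕ) : ℤ := ∏ k ∈ Finset.Icc 1 n, a k

/-- If the convergents `A n / B n` of `τ` have nonzero consecutive determinants, error
`|B n * τ - A n| ≤ B (n + 1) ^ (-s)`, and denominators growing at most like `B (n + 1) ≤ B n ^ t`,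
then every rational number approximates `τ` to order at most `1 + t / s`. -/
lemma exists_le_abs_sub_div_of_approx {τ s t : ℝ} {A B : ℕ → ℤ}
    (hdet : ∀ n, A (n + 1) * B n - A n * B (n + 1) ≠ 0)
    (hpos : ∀ n, 0 < B n) (hmono : Monotone B)
    (htop : Tendsto (fun n => (B n : ℝ)) atTop atTop) (hs : 0 < s) (ht : 0 < t)
    (happ : ∀ᶠ n in atTop, |(B n : ℝ) * τ - A n| ≤ (B (n + 1) : ℝ) ^ (-s))
    (hgrow : ∀ᶠ n in atTop, (B (n + 1) : ℝ) ≤ (B n : ℝ) ^ t) :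
    ∃ c > (0:ℝ), ∃ N₀ > (0:ℝ), ∀ M N : ℤ, (N : ℝ) ≥ N₀ →
      |τ - (M : ℝ) / (N : ℝ)| ≥ c / (N : ℝ) ^ (1 + t / s) := by
  obtain ⟨K, hK⟩ := eventually_atTop.1 (happ.and hgrow)
  have hposR : ∀ n, (0:ℝ) < B n := fun n => by exact_mod_cast hpos n
  have hmonoR : ∀ {m n : ℕ}, m ≤ n → (B m : ℝ) ≤ B n := fun h => by exact_mod_cast hmono h
  refine ⟨1 / (2 * 2 ^ (t / s)), by positivity, max 1 ((B K : ℝ) ^ s), by positivity, ?_⟩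
  intro M N hN
  have hN1 : (1:ℝ) ≤ N := (le_max_left _ _).trans hN
  have hN0 : (0:ℝ) < N := by linarith
  have hNK : (B K : ℝ) ^ s ≤ N := (le_max_right _ _).trans hN
  have hex : ∃ m, 2 * (N : ℝ) < (B m : ℝ) ^ s :=
    (((tendsto_rpow_atTop hs).comp htop).eventually_gt_atTop (2 * (N : ℝ))).exists
  classical
  obtain ⟨m, hm, hmin⟩ : ∃ m, 2 * (N : ℝ) < (B m : ℝ) ^ s ∧
      ∀ k < m, (B k : ℝ) ^ s ≤ 2 * N :=
    ⟨Nat.find hex, Nat.find_spec hex, fun k hk => not_lt.1 (Nat.find_min hex hk)⟩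
  have hKm : K < m := by
    by_contra! h
    have := rpow_le_rpow (hposR m).le (hmonoR h) hs.le
    linarith
  obtain ⟨n, rfl⟩ : ∃ n, m = n + 1 := ⟨m - 1, by omega⟩
  have hBn : (B n : ℝ) ^ s ≤ 2 * N := hmin n (by omega)
  have hBt : (B (n + 1) : ℝ) ≤ (2 * N : ℝ) ^ (t / s) := by
    calc (B (n + 1) : ℝ) ≤ (B n : ℝ) ^ t := (hK n (by omega)).2
      _ = ((B n : ℝ) ^ s) ^ (t / s) := by
        rw [← rpow_mul (hposR n).le]
        congr 1
        field_simp
      _ ≤ _ := rpow_le_rpow (rpow_nonneg (hposR n).le _) hBn (by positivity)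
  have herr : ∀ k, n ≤ k → (N : ℝ) * |(B k : ℝ) * τ - A k| ≤ 1 / 2 := by
    intro k hk
    have h1 := (hK k (by omega)).1
    have h2 : (B (n + 1) : ℝ) ^ s ≤ (B (k + 1) : ℝ) ^ s :=
      rpow_le_rpow (hposR _).le (hmonoR (by omega)) hs.le
    rw [rpow_neg (hposR _).le] at h1
    calc (N : ℝ) * |(B k : ℝ) * τ - A k| ≤ N * ((B (k + 1) : ℝ) ^ s)⁻¹ := by gcongr
      _ ≤ N * (2 * (N : ℝ))⁻¹ := by gcongr; linarith
      _ = 1 / 2 := by field_simp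
  obtain ⟨k, hnk, hkn, hne⟩ : ∃ k, n ≤ k ∧ k ≤ n + 1 ∧ A k * N - M * B k ≠ 0 := by
    by_contra! h
    have e1 := h n le_rfl (by omega)
    have e2 := h (n + 1) (by omega) le_rfl
    have hNz : N ≠ 0 := by rintro rfl; simp at hN0
    apply hdet n
    apply mul_left_cancel₀ hNz
    linear_combination B n * e2 - B (n + 1) * e1
  have hone : (1:ℝ) ≤ |(A k : ℝ) * N - M * B k| := by
    exact_mod_cast Int.one_le_abs hne
  have hsplit : |(A k : ℝ) * N - M * B k| ≤
      N * B k * |τ - M / N| + N * |(B k : ℝ) * τ - A k| := by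
    have e : (A k : ℝ) * N - M * B k =
        N * B k * (τ - M / N) - N * ((B k : ℝ) * τ - A k) := by
      field_simp
      ring
    rw [e]
    refine (abs_sub _ _).trans ?_
    rw [abs_mul, abs_mul (N : ℝ) (_ - _), abs_of_pos hN0,
      abs_of_pos (mul_pos hN0 (hposR k))]
  have hlow : 1 / 2 ≤ N * B k * |τ - M / N| := by linarith [herr k hnk]
  have hBk : (B k : ℝ) ≤ 2 ^ (t / s) * (N : ℝ) ^ (t / s) := by
    rw [← mul_rpow (by norm_num) hN0.le]
    exact (hmonoR hkn).trans hBt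
  have hfin : 1 / 2 ≤ N * (2 ^ (t / s) * (N : ℝ) ^ (t / s)) * |τ - M / N| :=
    hlow.trans (by gcongr)
  rw [ge_iff_le, rpow_add hN0, rpow_one, div_div, div_le_iff₀ (by positivity)]
  linarith

/-- A real number all of whose rational approximations are eventually bounded away by a positive
multiple of a power of the denominator is irrational. -/
lemma irrational_of_le_abs_sub_div {τ μ : ℝ}
    (h : ∃ c > (0:ℝ), ∃ N₀ > (0:ℝ), ∀ M N : ℤ, (N : ℝ) ≥ N₀ →
      |τ - (M : ℝ) / (N : ℝ)| ≥ c / (N : ℝ) ^ μ) : Irrational τ := by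
  obtain ⟨c, hc, N₀, hN₀, h⟩ := h
  rintro ⟨r, rfl⟩
  obtain ⟨k, hk⟩ := exists_nat_ge N₀
  have hk0 : (0:ℝ) < k := hN₀.trans_le hk
  have hd : (1:ℝ) ≤ r.den := by exact_mod_cast r.pos
  have hN : ((k * r.den : ℤ) : ℝ) ≥ N₀ := by
    push_cast
    nlinarith
  have := h (k * r.num) (k * r.den) hN
  have hz : (r : ℝ) - ((k * r.num : ℤ) : ℝ) / ((k * r.den : ℤ) : ℝ) = 0 := by
    have : (r : ℝ) = r.num / r.den := by exact_mod_cast (Rat.num_div_den r).symm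
    rw [this]
    push_cast
    field_simp
    simp
  rw [hz, abs_zero] at this
  exact absurd this (not_le.2 (div_pos hc (rpow_pos_of_pos (hN₀.trans_le hN) _)))

section Convergents

variable {a b : ℕ → ℤ}

lemma cfPi_succ (a : ℕ → ℤ) (n : ℕ) : cfPi a (n + 1) = cfPi a n * a (n + 1) :=
  Finset.prod_Icc_succ_top (by omega) _

lemma cfPi_pos (ha : ∀ n, 1 ≤ n → 0 < a n) (n : ℕ) : 0 < cfPi a n :=
  Finset.prod_pos fun k hk => ha k (Finset.mem_Icc.1 hk).1

lemma cfA_mul_cfB_sub (a b : ℕ → ℤ) (n : ℕ) :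
    cfA a b (n + 1) * cfB a b n - cfA a b n * cfB a b (n + 1) = (-1) ^ n * cfPi a (n + 1) := by
  induction n with
  | zero => simp [cfA, cfB, cfPi]
  | succ n ih =>
    rw [cfPi_succ, cfA, cfB]
    linear_combination (-a (n + 2)) * ih

lemma cfB_pos (ha : ∀ n, 1 ≤ n → 0 < a n) (hb : ∀ n, 1 ≤ n → 0 < b n) (n : ℕ) :
    0 < cfB a b n := by
  induction n using Nat.twoStepInduction with
  | zero => simp [cfB]
  | one => simpa [cfB] using hb 1 le_rfl
  | more n h0 h1 =>
    have := hb (n + 2) (by omega)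
    have := ha (n + 2) (by omega)
    rw [cfB]
    positivity

lemma cfB_add_one_le (ha : ∀ n, 1 ≤ n → 0 < a n) (hb : ∀ n, 1 ≤ n → 0 < b n) (n : ℕ) :
    cfB a b (n + 1) + 1 ≤ cfB a b (n + 2) := by
  have h0 := cfB_pos ha hb n
  have h1 := cfB_pos ha hb (n + 1)
  have h2 := hb (n + 2) (by omega)
  have h3 := ha (n + 2) (by omega)
  rw [cfB]
  nlinarith

lemma cfB_monotone (ha : ∀ n, 1 ≤ n → 0 < a n) (hb : ∀ n, 1 ≤ n → 0 < b n) :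
    Monotone (cfB a b) := by
  refine monotone_nat_of_le_succ fun n => ?_
  cases n with
  | zero => simpa [cfB] using Int.add_one_le_of_lt (hb 1 le_rfl)
  | succ n => linarith [cfB_add_one_le ha hb n]

lemma tendsto_cfB_atTop (ha : ∀ n, 1 ≤ n → 0 < a n) (hb : ∀ n, 1 ≤ n → 0 < b n) :
    Tendsto (fun n => (cfB a b n : ℝ)) atTop atTop := by
  have h : ∀ n : ℕ, (n : ℤ) ≤ cfB a b n := by
    intro n
    induction n with
    | zero => simp [cfB]
    | succ n ih =>
      cases n with
      | zero => simpa [cfB] using Int.add_one_le_of_lt (hb 1 le_rfl)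
      | succ n =>
        have := cfB_add_one_le ha hb n
        push_cast at ih ⊢
        linarith
  exact tendsto_atTop_mono (fun n => by exact_mod_cast h n) tendsto_natCast_atTop_atTop

lemma cfPi_le_mul_cfB (ha : ∀ n, 1 ≤ n → 0 < a n) (hb : ∀ n, 1 ≤ n → 0 < b n) (n : ℕ) :
    cfPi a (n + 1) ≤ a 1 * (cfB a b n * cfB a b (n + 1)) := by
  induction n with
  | zero =>
    have := ha 1 le_rfl
    have := hb 1 le_rfl
    simp only [cfPi, cfB, zero_add, Finset.Icc_self, Finset.prod_singleton]
    nlinarith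
  | succ n ih =>
    have h1 := ha 1 le_rfl
    have h2 := ha (n + 2) (by omega)
    have h3 := hb (n + 2) (by omega)
    have p1 := cfB_pos ha hb (n + 1)
    calc cfPi a (n + 2) = cfPi a (n + 1) * a (n + 2) := cfPi_succ a (n + 1)
      _ ≤ a 1 * (cfB a b n * cfB a b (n + 1)) * a (n + 2) := by gcongr
      _ = a 1 * (cfB a b (n + 1) * (0 + a (n + 2) * cfB a b n)) := by ring
      _ ≤ a 1 * (cfB a b (n + 1) * cfB a b (n + 2)) := by
        rw [cfB]
        gcongr
        positivity

/-- The distance between the convergents of index `n` and `n + 1`. -/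
noncomputable def cfGap (a b : ℕ → ℤ) (n : ℕ) : ℝ :=
  cfPi a (n + 1) / (cfB a b n * cfB a b (n + 1))

lemma cfGap_antitone (ha : ∀ n, 1 ≤ n → 0 < a n) (hb : ∀ n, 1 ≤ n → 0 < b n) :
    Antitone (cfGap a b) := by
  refine antitone_nat_of_succ_le fun n => ?_
  have h0 : (0:ℝ) < cfB a b n := by exact_mod_cast cfB_pos ha hb n
  have h1 : (0:ℝ) < cfB a b (n + 1) := by exact_mod_cast cfB_pos ha hb (n + 1)
  have h2 : (0:ℝ) < cfB a b (n + 2) := by exact_mod_cast cfB_pos ha hb (n + 2)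
  have hP : (0:ℝ) < cfPi a (n + 1) := by exact_mod_cast cfPi_pos ha (n + 1)
  have h3 : (0:ℝ) < b (n + 2) := by exact_mod_cast hb (n + 2) (by omega)
  have hle : (a (n + 2) : ℝ) * cfB a b n ≤ cfB a b (n + 2) := by
    rw [cfB]
    push_cast
    have := mul_pos h3 h1
    linarith
  unfold cfGap
  rw [cfPi_succ, div_le_div_iff₀ (by positivity) (by positivity)]
  push_cast
  calc (cfPi a (n + 1) : ℝ) * a (n + 2) * (cfB a b n * cfB a b (n + 1))
      = cfPi a (n + 1) * cfB a b (n + 1) * (a (n + 2) * cfB a b n) := by ring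
    _ ≤ cfPi a (n + 1) * cfB a b (n + 1) * cfB a b (n + 2) := by gcongr
    _ = _ := by ring

lemma sum_cfGap (ha : ∀ n, 1 ≤ n → 0 < a n) (hb : ∀ n, 1 ≤ n → 0 < b n) (n : ℕ) :
    ∑ i ∈ Finset.range n, (-1) ^ i * cfGap a b i = (cfA a b n : ℝ) / cfB a b n := by
  induction n with
  | zero => simp [cfA]
  | succ n ih =>
    have h0 : (cfB a b n : ℝ) ≠ 0 := by exact_mod_cast (cfB_pos ha hb n).ne'
    have h1 : (cfB a b (n + 1) : ℝ) ≠ 0 := by exact_mod_cast (cfB_pos ha hb (n + 1)).ne'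
    have hdet : (cfA a b (n + 1) : ℝ) * cfB a b n - cfA a b n * cfB a b (n + 1) =
        (-1) ^ n * cfPi a (n + 1) := by exact_mod_cast cfA_mul_cfB_sub a b n
    rw [Finset.sum_range_succ, ih, cfGap]
    field_simp
    linear_combination -hdet

/-- If the gaps tend to zero, the convergents converge, with error at most the next gap. -/
lemma exists_tendsto_of_cfGap (ha : ∀ n, 1 ≤ n → 0 < a n) (hb : ∀ n, 1 ≤ n → 0 < b n)
    (h0 : Tendsto (cfGap a b) atTop (nhds 0)) :
    ∃ τ : ℝ, Tendsto (fun n => (cfA a b n : ℝ) / (cfB a b n : ℝ)) atTop (nhds τ) ∧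
      ∀ n, |τ - (cfA a b n : ℝ) / cfB a b n| ≤ cfGap a b n := by
  have hanti := cfGap_antitone ha hb
  obtain ⟨τ, hτ⟩ := hanti.tendsto_alternating_series_of_tendsto_zero h0
  refine ⟨τ, by simpa only [sum_cfGap ha hb] using hτ, fun n => ?_⟩
  have hstep := Finset.sum_range_succ (fun i => (-1) ^ i * cfGap a b i) n
  rw [← sum_cfGap ha hb n]
  rcases Nat.even_or_odd' n with ⟨k, rfl | rfl⟩
  · have l := hanti.alternating_series_le_tendsto hτ k
    have u := hanti.tendsto_le_alternating_series hτ k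
    rw [hstep, Even.neg_one_pow ⟨k, by ring⟩] at u
    rw [abs_of_nonneg (by linarith)]
    linarith
  · have l := hanti.alternating_series_le_tendsto hτ (k + 1)
    have u := hanti.tendsto_le_alternating_series hτ k
    rw [show 2 * (k + 1) = 2 * k + 1 + 1 by ring, hstep, Odd.neg_one_pow ⟨k, rfl⟩] at l
    rw [abs_of_nonpos (by linarith)]
    linarith

lemma eventually_one_lt_cfB (ha : ∀ n, 1 ≤ n → 0 < a n) (hb : ∀ n, 1 ≤ n → 0 < b n) :
    ∀ᶠ n in atTop, (1:ℝ) < cfB a b n :=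
  (tendsto_cfB_atTop ha hb).eventually_gt_atTop 1

lemma le_rpow_of_log_div_log_lt {x B r : ℝ} (hB : 1 < B) (h : log x / log B < r) :
    x ≤ B ^ r := by
  rw [div_lt_iff₀ (log_pos hB)] at h
  exact le_rpow_of_log_le (by linarith) h.le

lemma isBoundedUnder_log_cfPi (ha : ∀ n, 1 ≤ n → 0 < a n) (hb : ∀ n, 1 ≤ n → 0 < b n) :
    IsBoundedUnder (· ≤ ·) atTop
      (fun n => log (cfPi a n : ℝ) / log (cfB a b n : ℝ)) := by
  refine isBoundedUnder_of_eventually_le (a := 3) ?_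
  filter_upwards [(tendsto_cfB_atTop ha hb).eventually_ge_atTop (a 1 : ℝ),
    eventually_one_lt_cfB ha hb, eventually_ge_atTop 1] with n h1 h2 hn
  obtain ⟨m, rfl⟩ : ∃ m, n = m + 1 := ⟨n - 1, by omega⟩
  have hP : (0:ℝ) < cfPi a (m + 1) := by exact_mod_cast cfPi_pos ha (m + 1)
  have hBm : (0:ℝ) < cfB a b m := by exact_mod_cast cfB_pos ha hb m
  have hmono : (cfB a b m : ℝ) ≤ cfB a b (m + 1) := by
    exact_mod_cast cfB_monotone ha hb (Nat.le_succ m)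
  have hle : (cfPi a (m + 1) : ℝ) ≤ a 1 * (cfB a b m * cfB a b (m + 1)) := by
    exact_mod_cast cfPi_le_mul_cfB ha hb m
  have hcube : (cfPi a (m + 1) : ℝ) ≤ (cfB a b (m + 1) : ℝ) ^ 3 := by
    calc _ ≤ _ := hle
      _ ≤ (cfB a b (m + 1) : ℝ) * (cfB a b (m + 1) * cfB a b (m + 1)) := by gcongr
      _ = _ := by ring
  rw [div_le_iff₀ (log_pos h2)]
  simpa using log_le_log hP hcube

end Convergents

/-- if `log B_{n+1} / log B_n → 1` and
`limsup log Π_n / log B_n ≤ ν < 1`, then the generalized continued fraction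
converges to an irrational `τ` with `μ_I(τ) ≤ 2 + ν/(1-ν)`. -/
theorem gcf_muI_le_of_log_growth
    (a b : ℕ → ℤ) (ha : ∀ n, 1 ≤ n → 0 < a n) (hb : ∀ n, 1 ≤ n → 0 < b n)
    (ν : ℝ) (hν : ν < 1)
    (hB : Tendsto (fun n => Real.log (cfB a b (n + 1) : ℝ) / Real.log (cfB a b n : ℝ))
      atTop (nhds 1))
    (hPi : limsup (fun n => Real.log (cfPi a n : ℝ) / Real.log (cfB a b n : ℝ)) atTop ≤ ν) :
    ∃ τ : ℝ,
      Tendsto (fun n => (cfA a b n : ℝ) / (cfB a b n : ℝ)) atTop (nhds τ) ∧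
      Irrational τ ∧
      muI τ ≤ ((2 + ν / (1 - ν) : ℝ) : EReal) := by
  have hBpos : ∀ n, (0:ℝ) < cfB a b n := fun n => by exact_mod_cast cfB_pos ha hb n
  have hBtop := tendsto_cfB_atTop ha hb
  have hgrow : ∀ ε > (0:ℝ), ∀ᶠ n in atTop, (cfB a b (n + 1) : ℝ) ≤ (cfB a b n : ℝ) ^ (1 + ε) := by
    intro ε hε
    filter_upwards [hB.eventually_lt_const (show (1:ℝ) < 1 + ε by linarith),
      eventually_one_lt_cfB ha hb] with n h1 h2
    exact le_rpow_of_log_div_log_lt h2 h1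
  have hgap : ∀ ε > (0:ℝ), ∀ᶠ n in atTop,
      cfB a b n * cfGap a b n ≤ (cfB a b (n + 1) : ℝ) ^ (-(1 - ν - ε)) := by
    intro ε hε
    have hlim := eventually_lt_of_limsup_lt (hPi.trans_lt (show ν < ν + ε by linarith))
      (isBoundedUnder_log_cfPi ha hb)
    filter_upwards [(tendsto_add_atTop_nat 1).eventually
      (hlim.and (eventually_one_lt_cfB ha hb))] with n hn
    have hP := le_rpow_of_log_div_log_lt hn.2 hn.1
    have h0 := (hBpos n).ne'
    calc cfB a b n * cfGap a b n = cfPi a (n + 1) / cfB a b (n + 1) := by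
          rw [cfGap]
          field_simp
      _ ≤ (cfB a b (n + 1) : ℝ) ^ (ν + ε) / cfB a b (n + 1) :=
          div_le_div_of_nonneg_right hP (hBpos _).le
      _ = _ := by
          rw [← rpow_sub_one (hBpos _).ne']
          congr 1
          ring
  have hgap0 : Tendsto (cfGap a b) atTop (nhds 0) := by
    have hs : 0 < 1 - ν - (1 - ν) / 2 := by linarith
    have hlim := ((tendsto_rpow_neg_atTop hs).comp hBtop).comp (tendsto_add_atTop_nat 1)
    have hnonneg : ∀ n, 0 ≤ cfGap a b n := fun n =>
      div_nonneg (by exact_mod_cast (cfPi_pos ha _).le) (mul_pos (hBpos _) (hBpos _)).le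
    refine squeeze_zero' (.of_forall hnonneg) ?_ hlim
    filter_upwards [hgap ((1 - ν) / 2) (by linarith)] with n hn
    have h1 : (1:ℝ) ≤ cfB a b n := by exact_mod_cast cfB_pos ha hb n
    exact (le_mul_of_one_le_left (hnonneg n) h1).trans hn
  obtain ⟨τ, hτ, herr⟩ := exists_tendsto_of_cfGap ha hb hgap0
  have hbound : ∀ ε > (0:ℝ), ε < 1 - ν → ∃ c > (0:ℝ), ∃ N₀ > (0:ℝ), ∀ M N : ℤ, (N : ℝ) ≥ N₀ →
      |τ - (M : ℝ) / (N : ℝ)| ≥ c / (N : ℝ) ^ (1 + (1 + ε) / (1 - ν - ε)) := by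
    intro ε hε hεν
    refine exists_le_abs_sub_div_of_approx (A := cfA a b) (B := cfB a b) (fun n => ?_)
      (cfB_pos ha hb) (cfB_monotone ha hb) hBtop (by linarith) (by linarith) ?_ (hgrow ε hε)
    · rw [cfA_mul_cfB_sub]
      exact mul_ne_zero (by simp) (cfPi_pos ha _).ne'
    · filter_upwards [hgap ε hε] with n hn
      refine le_trans ?_ hn
      have e : (cfB a b n : ℝ) * τ - cfA a b n =
          cfB a b n * (τ - (cfA a b n : ℝ) / cfB a b n) := by
        have := (hBpos n).ne'
        field_simp
      rw [e, abs_mul, abs_of_pos (hBpos n)]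
      exact mul_le_mul_of_nonneg_left (herr n) (hBpos n).le
  refine ⟨τ, hτ, irrational_of_le_abs_sub_div
    (hbound ((1 - ν) / 2) (by linarith) (by linarith)), ?_⟩
  have hcont : Tendsto (fun ε : ℝ => 1 + (1 + ε) / (1 - ν - ε)) (nhdsWithin 0 (Set.Ioi 0))
      (nhds (2 + ν / (1 - ν))) := by
    have hν' : 1 - ν ≠ 0 := by linarith
    have hc : ContinuousAt (fun ε : ℝ => 1 + (1 + ε) / (1 - ν - ε)) 0 := by
      refine continuousAt_const.add (ContinuousAt.div ?_ ?_ (by simpa using hν')) <;> fun_prop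
    have hval : 2 + ν / (1 - ν) = 1 + (1 + 0) / (1 - ν - 0) := by
      rw [add_zero, sub_zero]
      field_simp
      ring
    rw [hval]
    exact hc.tendsto.mono_left nhdsWithin_le_nhds
  refine ge_of_tendsto ((continuous_coe_real_ereal.tendsto _).comp hcont) ?_
  filter_upwards [Ioo_mem_nhdsGT (show (0:ℝ) < 1 - ν by linarith)] with ε hε
  exact sInf_le ⟨_, hbound ε hε.1 hε.2, rfl⟩
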